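/- arXiv:2402.09370 — 2 statements merged into one kernel-verified Lean document; each statement's English description precedes it below -/
import Mathlib

section
/- For all constants c > 0 and κ > 0 there is a negligible function ν such that the following holds for every n, with ℓ = ⌈κ·n⌉, and every binary autoregressive process given by functions p̂_i : {0,1}^{i−1} → [0,1]. Sample x uniformly from {0,1}^ℓ, and then sample bits t_1, …, t_ℓ sequentially with Pr[t_i = 1 | t_1,…,t_{i−1}, x] = p̂_i(t_{<i}) − (−1)^{x_i} · min{p̂_i(t_{<i}), 1 − p̂_i(t_{<i})}. Then the probability that simultaneously wt(t ⊕ x) > (1/2 − c²/16)·ℓ and Σ_{i=1}^{ℓ} H_e^i(t) > c·ℓ is at most ν(n), where H_e^i(t) is the empirical entropy of bit t_i with respect to the unmodified process p̂. -/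
open Finset
open scoped Classical

noncomputable section

/-- `ν : ℕ → ℝ` is negligible if for every `k`, `ν n ≤ n⁻ᵏ` for all sufficiently large `n`. -/
def Negligible (ν : ℕ → ℝ) : Prop :=
  ∀ k : ℕ, ∃ N : ℕ, ∀ n ≥ N, ν n ≤ 1 / (n : ℝ) ^ k

/-- The empirical entropy `H_e^i(t)` of the `i`-th bit of the sequence `T` with respect to
the binary autoregressive process `p` (logarithms base 2). -/
def empEnt (p : (i : ℕ) → (Fin i → Bool) → ℝ) (T : ℕ → Bool) (i : ℕ) : ℝ :=
  if T i then -Real.logb 2 (p i (fun j => T j.1))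
  else -Real.logb 2 (1 - p i (fun j => T j.1))

/-- Extend a finite bitstring to `ℕ → Bool` by zeros. -/
def extBits {b : ℕ} (t : Fin b → Bool) : ℕ → Bool :=
  fun i => if h : i < b then t ⟨i, h⟩ else false

/-- The watermark-biased next-bit probability: if the unmodified process would output `1`
with probability `p̂`, then given seed bit `x_i` the biased probability is
`p̂ − (−1)^{x_i}·min{p̂, 1 − p̂}`. -/
def biased (phat : ℝ) (xi : Bool) : ℝ :=
  phat + (if xi then min phat (1 - phat) else -(min phat (1 - phat)))

lemma aux_sum_prod (f : (i : ℕ) → (Fin i → Bool) → Bool → Bool → ℝ) (r : ℝ)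
    (hf : ∀ i h x t, 0 ≤ f i h x t)
    (hr : ∀ i h, ∑ x : Bool, ∑ t : Bool, f i h x t ≤ r) (l : ℕ) :
    ∑ x : Fin l → Bool, ∑ t : Fin l → Bool,
      ∏ i ∈ Finset.range l, f i (fun j => extBits t j.1) (extBits x i) (extBits t i) ≤ r ^ l := by
  have hr0 : 0 ≤ r := le_trans (Finset.sum_nonneg fun x _ => Finset.sum_nonneg fun t _ =>
    hf 0 (fun _ => false) x t) (hr 0 (fun _ => false))
  induction l with
  | zero => simp
  | succ l ih =>
    have e1 : ∀ (b : Bool) (t : Fin l → Bool) (i : ℕ), i < l →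
        extBits (Fin.snocEquiv (fun _ => Bool) (b, t)) i = extBits t i := by
      intro b t i hi
      have : i < l + 1 := by omega
      simp [extBits, hi, this, Fin.snocEquiv, Fin.snoc]
    have e2 : ∀ (b : Bool) (t : Fin l → Bool),
        extBits (Fin.snocEquiv (fun _ => Bool) (b, t)) l = b := by
      intro b t
      simp [extBits, Fin.snocEquiv, Fin.snoc]
    have key : ∀ (b b' : Bool) (x t : Fin l → Bool),
        ∏ i ∈ Finset.range (l+1),
          f i (fun j => extBits (Fin.snocEquiv (fun _ => Bool) (b', t)) j.1)
            (extBits (Fin.snocEquiv (fun _ => Bool) (b, x)) i)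
            (extBits (Fin.snocEquiv (fun _ => Bool) (b', t)) i)
        = (∏ i ∈ Finset.range l, f i (fun j => extBits t j.1) (extBits x i) (extBits t i)) *
          f l (fun j => extBits t j.1) b b' := by
      intro b b' x t
      rw [Finset.prod_range_succ, e2, e2]
      congr 1
      · refine Finset.prod_congr rfl fun i hi => ?_
        have hi := Finset.mem_range.1 hi
        rw [e1 _ _ _ hi, e1 _ _ _ hi]
        congr 1
        funext j
        exact e1 _ _ _ (by omega)
      · congr 1
        funext j
        exact e1 _ _ _ j.2
    rw [← (Fin.snocEquiv (fun _ => Bool)).sum_comp, Fintype.sum_prod_type]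
    simp_rw [← (Fin.snocEquiv (n := l) (fun _ => Bool)).sum_comp
      (fun t => ∏ i ∈ Finset.range (l+1), f i (fun j => extBits t j.1) _ (extBits t i)),
      Fintype.sum_prod_type, key]
    calc _ = ∑ x : Fin l → Bool, ∑ t : Fin l → Bool,
        (∏ i ∈ Finset.range l, f i (fun j => extBits t j.1) (extBits x i) (extBits t i)) *
          ∑ b : Bool, ∑ b' : Bool, f l (fun j => extBits t j.1) b b' := by
          rw [Finset.sum_comm]
          refine Finset.sum_congr rfl fun x _ => ?_
          simp only [Fintype.sum_bool, ← Finset.sum_add_distrib]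
          refine Finset.sum_congr rfl fun t _ => ?_
          ring
      _ ≤ ∑ x : Fin l → Bool, ∑ t : Fin l → Bool,
        (∏ i ∈ Finset.range l, f i (fun j => extBits t j.1) (extBits x i) (extBits t i)) * r := by
          gcongr with x _ t _
          · exact Finset.prod_nonneg fun i _ => hf _ _ _ _
          · exact hr _ _
      _ ≤ r ^ (l+1) := by
          simp_rw [← Finset.sum_mul]
          rw [pow_succ]
          gcongr

lemma aux_exp_quad (y : ℝ) (hy : 0 ≤ y) : Real.exp y ≤ 1 + y + y ^ 2 * Real.exp y := by
  have h1 : Real.exp y - 1 ≤ y * Real.exp y := by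
    have h := Real.add_one_le_exp (-y)
    have h2 : Real.exp (-y) * Real.exp y = 1 := by rw [← Real.exp_add]; simp
    nlinarith [Real.exp_pos y]
  nlinarith

lemma aux_exp_one (y : ℝ) (hy : 0 ≤ y) (hy1 : y ≤ 1) : Real.exp y ≤ 1 + y + y ^ 2 := by
  have := Real.abs_exp_sub_one_sub_id_le (x := y) (by rwa [abs_of_nonneg hy])
  linarith [(abs_le.1 this).2]

lemma aux_part1 (p β : ℝ) (hp : 0 ≤ p) (hp1 : p ≤ 1) (hβ : 0 ≤ β) (hβ1 : β ≤ 1/2) :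
    p * Real.exp (-(β * Real.log p)) ≤ p + β * (p * -Real.log p) + 16 * β ^ 2 := by
  rcases hp.eq_or_lt with rfl | hp
  · simp; positivity
  obtain ⟨L, hL⟩ : ∃ L, L = -Real.log p := ⟨_, rfl⟩
  have hL0 : 0 ≤ L := by rw [hL]; linarith [Real.log_nonpos hp.le hp1]
  have hpe : p = Real.exp (-L) := by rw [hL, neg_neg, Real.exp_log hp]
  have h1 := aux_exp_quad (β * L) (by positivity)
  have h2 : L ≤ 4 * Real.exp (L/4) := by linarith [Real.add_one_le_exp (L/4)]
  have h3 : L ^ 2 ≤ 16 * Real.exp (L/2) := by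
    have : Real.exp (L/2) = Real.exp (L/4) * Real.exp (L/4) := by
      rw [← Real.exp_add]; ring_nf
    rw [this]; nlinarith [Real.exp_pos (L/4)]
  have h4 : p * (L ^ 2 * Real.exp (β * L)) ≤ 16 := by
    calc p * (L ^ 2 * Real.exp (β * L)) ≤ p * (16 * Real.exp (L/2) * Real.exp (L/2)) := by
          gcongr; nlinarith
      _ = 16 * (p * Real.exp L) := by
          have : Real.exp L = Real.exp (L/2) * Real.exp (L/2) := by
            rw [← Real.exp_add]; ring_nf
          rw [this]; ring
      _ = 16 := by rw [hpe, ← Real.exp_add]; simp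
  have e : -(β * Real.log p) = β * L := by rw [hL]; ring
  rw [e, ← hL]
  have h5 := mul_le_mul_of_nonneg_left h1 hp.le
  have h6 := mul_le_mul_of_nonneg_left h4 (sq_nonneg β)
  nlinarith

lemma aux_ent (p : ℝ) (hp : 0 ≤ p) (hp1 : p ≤ 1/2) :
    p * -Real.log p + (1 - p) * -Real.log (1 - p) ≤ 2 * Real.sqrt p := by
  have h1 : (1 - p) * -Real.log (1 - p) ≤ p := by
    have h := Real.one_sub_inv_le_log_of_pos (x := 1 - p) (by linarith)
    have h' : (1 - p) * (1 - p)⁻¹ = 1 := mul_inv_cancel₀ (by linarith)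
    nlinarith
  rcases hp.eq_or_lt with rfl | hp
  · simp
  have hs : 0 < Real.sqrt p := Real.sqrt_pos.2 hp
  have hsq : Real.sqrt p * Real.sqrt p = p := Real.mul_self_sqrt hp.le
  have h := Real.one_sub_inv_le_log_of_pos hs
  have hl : Real.log p = 2 * Real.log (Real.sqrt p) := by
    rw [Real.log_sqrt hp.le]; ring
  have h' : p * (Real.sqrt p)⁻¹ = Real.sqrt p := by
    nth_rewrite 1 [← hsq]; field_simp
  have h2 : p * -Real.log p ≤ 2 * Real.sqrt p - 2 * p := by
    rw [hl]
    have := mul_le_mul_of_nonneg_left h hp.le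
    nlinarith
  linarith

lemma aux_core (p a β : ℝ) (hp : 0 ≤ p) (hp1 : p ≤ 1/2) (ha : 0 ≤ a) (ha1 : a ≤ 1)
    (hβ : 0 ≤ β) (hβ1 : β ≤ 1/2) :
    p * Real.exp (-(β * Real.log p)) +
      Real.exp (-(β * Real.log (1 - p))) * (1/2 + (1/2 - p) * Real.exp a)
    ≤ 1 + a/2 - a * p + 2 * β * Real.sqrt p + (18 * β ^ 2 + β * a + a ^ 2 / 2) := by
  have h1 := aux_part1 p β hp (by linarith) hβ hβ1
  have h2 := aux_ent p hp hp1
  obtain ⟨M, hM⟩ : ∃ M, M = -Real.log (1 - p) := ⟨_, rfl⟩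
  have hM0 : 0 ≤ M := by rw [hM]; linarith [Real.log_nonpos (x := 1 - p) (by linarith) (by linarith)]
  have hM1 : M ≤ 1 := by
    have h := Real.one_sub_inv_le_log_of_pos (x := 1 - p) (by linarith)
    have : (1 - p)⁻¹ ≤ 2 := by
      rw [inv_le_comm₀ (by linarith) (by norm_num)]; linarith
    linarith
  have e : -(β * Real.log (1 - p)) = β * M := by rw [hM]; ring
  rw [← hM] at h2
  rw [e]
  have hy0 : 0 ≤ β * M := by positivity
  have hyβ : β * M ≤ β := by nlinarith
  have h3 := aux_exp_one (β * M) hy0 (by linarith)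
  have h4 := aux_exp_one a ha ha1
  have h5 : 1/2 + (1/2 - p) * Real.exp a ≤ 1 - p + (1/2 - p) * a + a ^ 2 / 2 := by
    nlinarith
  have h50 : 0 ≤ 1/2 + (1/2 - p) * Real.exp a := by
    have := mul_nonneg (by linarith : (0:ℝ) ≤ 1/2 - p) (Real.exp_pos a).le
    linarith
  have h6 : Real.exp (β * M) * (1/2 + (1/2 - p) * Real.exp a) ≤
      (1 + β * M + (β * M) ^ 2) * (1 - p + (1/2 - p) * a + a ^ 2 / 2) :=
    mul_le_mul h3 h5 h50 (by positivity)
  have h7 : (1 + β * M + (β * M) ^ 2) * (1 - p + (1/2 - p) * a + a ^ 2 / 2) ≤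
      (1 - p + (1/2 - p) * a + a ^ 2 / 2) + β * ((1 - p) * M) + β * a + 2 * β ^ 2 := by
    have i1 : (1/2 - p) * a + a ^ 2 / 2 ≤ a := by nlinarith
    have i2 : (β * M) * ((1/2 - p) * a + a ^ 2 / 2) ≤ β * a :=
      mul_le_mul hyβ i1 (by have := mul_nonneg (by linarith : (0:ℝ) ≤ 1/2 - p) ha; positivity) hβ
    have i3 : (β * M) ^ 2 * (1 - p + (1/2 - p) * a + a ^ 2 / 2) ≤ β ^ 2 * 2 := by
      refine mul_le_mul (by gcongr) (by linarith) ?_ (sq_nonneg _)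
      have := mul_nonneg (by linarith : (0:ℝ) ≤ 1/2 - p) ha
      nlinarith [sq_nonneg a]
    nlinarith
  have h8 := mul_le_mul_of_nonneg_left h2 hβ
  nlinarith

/-- one step weight -/
def stepW (c a p : ℝ) (x t : Bool) : ℝ :=
  (1/2) * (if t then biased p x else 1 - biased p x) *
    Real.exp (a * ((if t ≠ x then 1 else 0) - (1/2 - c ^ 2 / 16)) +
      a * c / 4 * ((if t then -Real.log p else -Real.log (1 - p)) - c * Real.log 2))

lemma stepW_nonneg (c a p : ℝ) (hp : 0 ≤ p) (hp1 : p ≤ 1) (x t : Bool) :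
    0 ≤ stepW c a p x t := by
  unfold stepW biased
  have h1 := min_le_left p (1 - p)
  have h2 := min_le_right p (1 - p)
  have h3 : 0 ≤ min p (1 - p) := le_min hp (by linarith)
  refine mul_nonneg (mul_nonneg (by norm_num) ?_) (Real.exp_pos _).le
  cases x <;> cases t <;> simp <;> linarith

lemma stepW_symm (c a p : ℝ) (x t : Bool) : stepW c a (1 - p) x t = stepW c a p (!x) (!t) := by
  unfold stepW biased
  have : min (1 - p) (1 - (1 - p)) = min p (1 - p) := by rw [min_comm]; simp
  rw [this]
  cases x <;> cases t <;> simp <;> ring_nf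

lemma stepW_half (c a p : ℝ) (hc : 0 < c) (ha : 0 < a) (ha1 : a ≤ 1) (hac : a * c ≤ 2)
    (hac2 : a * (2 + 2 * c + 2 * c ^ 2) ≤ c ^ 2 / 64) (hp : 0 ≤ p) (hp1 : p ≤ 1/2) :
    ∑ x : Bool, ∑ t : Bool, stepW c a p x t ≤ Real.exp (-(a * c ^ 2 / 64)) := by
  have hm : min p (1 - p) = p := min_eq_left (by linarith)
  have hcore := aux_core p a (a * c / 4) hp hp1 ha.le ha1 (by positivity) (by linarith)
  set β := a * c / 4 with hβ
  set K := Real.exp (-(a * (1/2 - c ^ 2 / 16)) - β * (c * Real.log 2)) with hK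
  have e : ∑ x : Bool, ∑ t : Bool, stepW c a p x t = K *
      (p * Real.exp (-(β * Real.log p)) +
      Real.exp (-(β * Real.log (1 - p))) * (1/2 + (1/2 - p) * Real.exp a)) := by
    have e1 : Real.exp (a * (0 - (1/2 - c ^ 2 / 16)) + β * (-Real.log p - c * Real.log 2))
        = K * Real.exp (-(β * Real.log p)) := by
      rw [hK, ← Real.exp_add]; ring_nf
    have e2 : Real.exp (a * (0 - (1/2 - c ^ 2 / 16)) + β * (-Real.log (1-p) - c * Real.log 2))
        = K * Real.exp (-(β * Real.log (1-p))) := by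
      rw [hK, ← Real.exp_add]; ring_nf
    have e3 : Real.exp (a * (1 - (1/2 - c ^ 2 / 16)) + β * (-Real.log (1-p) - c * Real.log 2))
        = K * Real.exp (-(β * Real.log (1-p))) * Real.exp a := by
      rw [hK, ← Real.exp_add, ← Real.exp_add]; ring_nf
    simp only [Fintype.sum_bool, stepW, biased, hm, ← hβ]
    simp only [ne_eq, not_true_eq_false, if_false, if_true, Bool.false_eq_true,
      reduceCtorEq, not_false_eq_true, e1, e2, e3]
    ring
  rw [e]
  have hsq : a * c / 2 * Real.sqrt p ≤ a * p + a * c ^ 2 / 16 := by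
    have := Real.mul_self_sqrt hp
    nlinarith [mul_nonneg ha.le (sq_nonneg (Real.sqrt p - c / 4))]
  have hsec : 18 * β ^ 2 + β * a + a ^ 2 / 2 ≤ a * c ^ 2 / 64 := by
    have h := mul_le_mul_of_nonneg_left hac2 ha.le
    have : 18 * β ^ 2 + β * a + a ^ 2 / 2 ≤ a * (a * (2 + 2 * c + 2 * c ^ 2)) := by
      have : 0 ≤ a ^ 2 * (3/2 + 7/4 * c + 7/8 * c ^ 2) := by positivity
      rw [hβ]; nlinarith
    linarith
  have hF : 1 + a/2 - a * p + 2 * β * Real.sqrt p + (18 * β ^ 2 + β * a + a ^ 2 / 2)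
      ≤ Real.exp (a/2 + a * c ^ 2 / 16 + a * c ^ 2 / 64) := by
    have := Real.add_one_le_exp (a/2 + a * c ^ 2 / 16 + a * c ^ 2 / 64)
    have hb : 2 * β * Real.sqrt p = a * c / 2 * Real.sqrt p := by rw [hβ]; ring
    linarith
  calc _ ≤ K * Real.exp (a/2 + a * c ^ 2 / 16 + a * c ^ 2 / 64) :=
        mul_le_mul_of_nonneg_left (hcore.trans hF) (Real.exp_pos _).le
    _ ≤ _ := by
      rw [hK, ← Real.exp_add]
      apply Real.exp_le_exp.2
      have h2 := Real.log_two_gt_d9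
      have h3 : 0 < a * c ^ 2 := by positivity
      have h4 : a * c ^ 2 * 0.69 ≤ a * c ^ 2 * Real.log 2 := by
        gcongr; linarith
      rw [hβ]; nlinarith

lemma stepW_sum (c a p : ℝ) (hc : 0 < c) (ha : 0 < a) (ha1 : a ≤ 1) (hac : a * c ≤ 2)
    (hac2 : a * (2 + 2 * c + 2 * c ^ 2) ≤ c ^ 2 / 64) (hp : 0 ≤ p) (hp1 : p ≤ 1) :
    ∑ x : Bool, ∑ t : Bool, stepW c a p x t ≤ Real.exp (-(a * c ^ 2 / 64)) := by
  rcases le_total p (1/2) with h | h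
  · exact stepW_half c a p hc ha ha1 hac hac2 hp h
  · have := stepW_half c a (1 - p) hc ha ha1 hac hac2 (by linarith) (by linarith)
    simp only [stepW_symm, Fintype.sum_bool, Bool.not_true, Bool.not_false] at this ⊢
    linarith

lemma aux_card {l : ℕ} (x t : Fin l → Bool) :
    ((univ.filter (fun i : Fin l => t i ≠ x i)).card : ℝ) =
      ∑ i ∈ Finset.range l, (if extBits t i ≠ extBits x i then (1:ℝ) else 0) := by
  rw [Finset.sum_range, Finset.card_filter]
  push_cast
  refine Finset.sum_congr rfl fun i _ => ?_
  simp [extBits]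

lemma aux_negl (d : ℝ) (hd : 0 < d) : Negligible (fun n => Real.exp (-(d * n))) := by
  intro k
  have h := Real.tendsto_pow_mul_exp_neg_atTop_nhds_zero k
  have h2 : Filter.Tendsto (fun n : ℕ => d * (n : ℝ)) Filter.atTop Filter.atTop :=
    Filter.Tendsto.const_mul_atTop hd tendsto_natCast_atTop_atTop
  have h3 := (h.comp h2).eventually (gt_mem_nhds (show (0:ℝ) < d ^ k by positivity))
  obtain ⟨N, hN⟩ := Filter.eventually_atTop.1 h3
  refine ⟨max N 1, fun n hn => ?_⟩
  have h4 := hN n (le_trans (le_max_left _ _) hn)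
  have hn1 : (0:ℝ) < n := by exact_mod_cast lt_of_lt_of_le Nat.one_pos (le_trans (le_max_right _ _) hn)
  simp only [Function.comp, mul_pow, mul_assoc] at h4
  rw [le_div_iff₀ (by positivity), mul_comm]
  have : (0:ℝ) < d ^ k := by positivity
  nlinarith

/-- For all constants `c > 0` and `κ > 0` there is a negligible `ν` such
that for every `n`, with `ℓ = ⌈κ·n⌉`, and every binary autoregressive process `p̂`:
sampling `x` uniform on `{0,1}^ℓ` and then the bits `t₁, …, t_ℓ` sequentially with
`Pr[tᵢ = 1 ∣ t_{<i}, x] = p̂ᵢ(t_{<i}) − (−1)^{xᵢ}·min{p̂ᵢ(t_{<i}), 1 − p̂ᵢ(t_{<i})}`, the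
probability that simultaneously `wt(t ⊕ x) > (1/2 − c²/16)·ℓ` and
`Σ_{i=1}^{ℓ} H_e^i(t) > c·ℓ` (empirical entropy w.r.t. the unmodified process `p̂`) is at
most `ν n`. -/
theorem stmt_16 (c κ : ℝ) (hc : 0 < c) (hκ : 0 < κ) :
    ∃ ν : ℕ → ℝ, Negligible ν ∧
      ∀ n : ℕ, ∀ p : (i : ℕ) → (Fin i → Bool) → ℝ,
        (∀ i h, p i h ∈ Set.Icc (0 : ℝ) 1) →
        ∀ l : ℕ, l = Nat.ceil (κ * n) →
          ∑ x : Fin l → Bool, ∑ t : Fin l → Bool,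
            ((1 / 2 ^ l : ℝ) *
              ∏ i ∈ Finset.range l,
                (if extBits t i then biased (p i (fun j => extBits t j.1)) (extBits x i)
                 else 1 - biased (p i (fun j => extBits t j.1)) (extBits x i))) *
            (if ((1/2 : ℝ) - c ^ 2 / 16) * (l : ℝ) <
                  ((univ.filter (fun i : Fin l => t i ≠ x i)).card : ℝ) ∧
                c * (l : ℝ) < ∑ i ∈ Finset.range l, empEnt p (extBits t) i
             then 1 else 0)
          ≤ ν n := by
  obtain ⟨a, ha, ha1, hac, hac2⟩ : ∃ a : ℝ, 0 < a ∧ a ≤ 1 ∧ a * c ≤ 2 ∧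
      a * (2 + 2 * c + 2 * c ^ 2) ≤ c ^ 2 / 64 := by
    refine ⟨min 1 (min (2 / c) (c ^ 2 / 64 / (2 + 2 * c + 2 * c ^ 2))), by positivity,
      min_le_left _ _, ?_, ?_⟩
    · rw [← le_div_iff₀ hc]
      exact (min_le_right _ _).trans (min_le_left _ _)
    · rw [← le_div_iff₀ (by positivity)]
      exact (min_le_right _ _).trans (min_le_right _ _)
  refine ⟨fun n => Real.exp (-(a * c ^ 2 / 64 * κ * n)), aux_negl _ (by positivity), ?_⟩
  intro n p hp l hl
  have hmain := aux_sum_prod (fun i h x t => stepW c a (p i h) x t)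
    (Real.exp (-(a * c ^ 2 / 64)))
    (fun i h x t => stepW_nonneg c a _ (hp i h).1 (hp i h).2 x t)
    (fun i h => stepW_sum c a _ hc ha ha1 hac hac2 (hp i h).1 (hp i h).2) l
  have hlast : Real.exp (-(a * c ^ 2 / 64)) ^ l ≤ Real.exp (-(a * c ^ 2 / 64 * κ * n)) := by
    rw [← Real.exp_nat_mul]
    apply Real.exp_le_exp.2
    have h1 : κ * n ≤ l := by rw [hl]; exact Nat.le_ceil _
    have h2 : 0 < a * c ^ 2 / 64 := by positivity
    nlinarith
  refine le_trans ?_ (hmain.trans hlast)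
  refine Finset.sum_le_sum fun x _ => Finset.sum_le_sum fun t _ => ?_
  have hlog : Real.log 2 ≠ 0 := (Real.log_pos (by norm_num)).ne'
  simp only [stepW, Finset.prod_mul_distrib, ← Real.exp_sum, Finset.prod_const,
    Finset.card_range]
  rw [one_div_pow]
  refine mul_le_mul_of_nonneg_left ?_ ?_
  · split_ifs with hev
    · obtain ⟨hw, hs⟩ := hev
      apply Real.one_le_exp
      rw [aux_card] at hw
      have hent : ∀ i, (if extBits t i = true then -Real.log (p i (fun j => extBits t j.1))
          else -Real.log (1 - p i (fun j => extBits t j.1))) =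
          empEnt p (extBits t) i * Real.log 2 := by
        intro i
        unfold empEnt Real.logb
        split_ifs <;> field_simp
      simp_rw [hent]
      rw [Finset.sum_add_distrib, ← Finset.mul_sum, ← Finset.mul_sum, Finset.sum_sub_distrib,
        Finset.sum_sub_distrib, Finset.sum_sub_distrib, ← Finset.sum_mul]
      simp only [Finset.sum_const, Finset.card_range, nsmul_eq_mul]
      have hl2 := Real.log_pos (show (1:ℝ) < 2 by norm_num)
      refine add_nonneg (mul_nonneg ha.le ?_) (mul_nonneg (by positivity) ?_)
      · linarith
      · nlinarith
    · exact (Real.exp_pos _).le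
  · refine mul_nonneg (by positivity) (Finset.prod_nonneg fun i _ => ?_)
    obtain ⟨q0, q1⟩ := hp i (fun j => extBits t j.1)
    generalize p i (fun j => extBits t j.1) = q at q0 q1
    have h1 := min_le_left q (1 - q)
    have h2 := min_le_right q (1 - q)
    have h3 : 0 ≤ min q (1 - q) := le_min q0 (by linarith)
    unfold biased
    cases extBits x i <;> cases extBits t i <;> simp <;> linarith


end
end

section
/- Let Σ be a finite nonempty set, let μ be a probability distribution on Σ, let f : Σ → {0,1} be a function, and let α > 0 satisfy min_{b∈{0,1}} Pr_{c←μ}[f(c) = b] ≥ α. Sample x uniformly from {0,1} and sample c¹, c² independently from μ (independent of x); set c = c¹ if f(c¹) = x and c = c² otherwise. Then Pr[f(c) = x] ≥ 1/2 + α/2. -/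
open Finset
open scoped Classical

/-- Let `μ` be a probability distribution on a finite nonempty set, let
`f` be a Boolean hash with `Pr_{c←μ}[f c = b] ≥ α` for both `b`.  Sample a uniform target
bit `x` and `c¹, c² ← μ` independently; output `c = c¹` if `f c¹ = x` and `c = c²`
otherwise.  Then `Pr[f c = x] ≥ 1/2 + α/2`. -/
theorem stmt_18 {A : Type*} [Fintype A] [Nonempty A] (μ : A → ℝ)
    (hμ0 : ∀ c, 0 ≤ μ c) (hμ1 : ∑ c, μ c = 1) (f : A → Bool) (α : ℝ) (hα : 0 < α)
    (hbias : ∀ b : Bool, α ≤ ∑ c, (if f c = b then μ c else 0)) :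
    1/2 + α/2 ≤
      ∑ x : Bool, ∑ c1 : A, ∑ c2 : A,
        (1/2 : ℝ) * μ c1 * μ c2 * (if f (if f c1 = x then c1 else c2) = x then 1 else 0) := by
  have key : ∀ x : Bool, (∑ c1 : A, ∑ c2 : A,
        (1/2 : ℝ) * μ c1 * μ c2 * (if f (if f c1 = x then c1 else c2) = x then 1 else 0))
      = (1/2) * (2 * (∑ c, (if f c = x then μ c else 0))
          - (∑ c, (if f c = x then μ c else 0)) * (∑ c, (if f c = x then μ c else 0))) := by
    intro x
    have h1 : ∀ c1 c2 : A,
        (1/2 : ℝ) * μ c1 * μ c2 * (if f (if f c1 = x then c1 else c2) = x then 1 else 0)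
        = (1/2) * ((if f c1 = x then μ c1 else 0) * μ c2
            + μ c1 * (if f c2 = x then μ c2 else 0)
            - (if f c1 = x then μ c1 else 0) * (if f c2 = x then μ c2 else 0)) := by
      intro c1 c2
      by_cases h : f c1 = x
      · by_cases h' : f c2 = x
        · simp only [h, h', if_true]; ring
        · simp only [h, h', if_true, if_false]; ring
      · by_cases h' : f c2 = x
        · simp only [h, h', if_true, if_false]; ring
        · simp only [h, h', if_false]; ring
    simp only [h1, ← Finset.mul_sum, Finset.sum_add_distrib, Finset.sum_sub_distrib,
      ← Finset.sum_mul, hμ1]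
    ring
  have hsum : (∑ c, (if f c = true then μ c else 0)) + (∑ c, (if f c = false then μ c else 0))
      = 1 := by
    rw [← Finset.sum_add_distrib, ← hμ1]
    refine Finset.sum_congr rfl fun c _ => ?_
    cases f c <;> simp
  have ht := hbias true
  have hf := hbias false
  rw [Fintype.sum_bool, key, key]
  generalize (∑ c, (if f c = true then μ c else 0)) = p at *
  generalize (∑ c, (if f c = false then μ c else 0)) = q at *
  obtain rfl : q = 1 - p := by linarith
  nlinarith [mul_nonneg (sub_nonneg.2 ht) (sub_nonneg.2 hf)]
end
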